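/- arXiv:2107.04066 — 2 statements merged into one kernel-verified Lean document; each statement's English description precedes it below -/
import Mathlib

section
/- Let D be a finite directed multigraph, let α be an edge weighting of D positive on every directed cycle, and let η be an edge weighting of D that is nonnegative on every directed cycle. Let D|η be the subgraph of D consisting of all edges (and their endpoints) traversed by η-null directed cycles, i.e., by directed cycles γ of D with η(γ) = 0. Then: (a) every directed cycle of D|η satisfies η(γ) = 0; and (b) if gr_{D|η}(α) > 1, then for every real t ≥ 0 the weighting α + tη is positive on every directed cycle of D, gr_D(α + tη) ≥ gr_{D|η}(α), and gr_D(α + tη) → gr_{D|η}(α) as t → ∞. -/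
/-- A finite directed multigraph on vertex type `V` and edge type `E`:
each edge has a source and a target vertex (loops and parallel edges allowed). -/
structure Multidigraph (V E : Type) where
  src : E → V
  tgt : E → V

namespace Multidigraph

variable {V E : Type} (D : Multidigraph V E)

/-- A cycle word: a nonempty list of edges that is cyclically composable. -/
def IsCycleWord (l : List E) : Prop :=
  l ≠ [] ∧ ∀ i j : Fin l.length, ((i : ℕ) + 1) % l.length = (j : ℕ) →
    D.tgt (l.get i) = D.src (l.get j)

/-- Cycle words up to cyclic rotation. -/
def cycleSetoid : Setoid { l : List E // D.IsCycleWord l } where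
  r a b := List.IsRotated a.1 b.1
  iseqv := ⟨fun a => List.IsRotated.refl a.1, fun h => h.symm, fun h h' => h.trans h'⟩

/-- A directed cycle of `D`: a cycle word considered up to cyclic rotation. -/
def Cycle := Quotient D.cycleSetoid

/-- The value of an edge weighting on a directed cycle: the sum of the weights
of the edges it traverses. -/
noncomputable def weight (α : E → ℝ) (c : D.Cycle) : ℝ :=
  Quotient.lift (fun l : { l : List E // D.IsCycleWord l } => (l.1.map α).sum)
    (fun a b h => by
      have h' : List.IsRotated a.1 b.1 := h
      exact List.Perm.sum_eq (List.Perm.map α (List.IsRotated.perm h'))) c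

/-- An edge lies on a directed cycle. -/
def EdgeMem (e : E) (c : D.Cycle) : Prop :=
  ∃ l : { l : List E // D.IsCycleWord l }, Quotient.mk D.cycleSetoid l = c ∧ e ∈ l.1

/-- A directed cycle is contained in the subgraph with edge set `E'`. -/
def CycleIn (E' : Set E) (c : D.Cycle) : Prop :=
  ∀ e : E, D.EdgeMem e c → e ∈ E'

/-- The growth rate of the directed cycles contained in the subgraph with edge set `E'`,
counted with respect to the edge weighting `α`:
`limsup_{L → ∞} (#{cycles γ in the subgraph with α(γ) ≤ L})^(1/L)`. -/
noncomputable def growthRateOn (E' : Set E) (α : E → ℝ) : ℝ :=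
  Filter.limsup
    (fun L : ℝ =>
      (Nat.card { c : D.Cycle | D.CycleIn E' c ∧ D.weight α c ≤ L } : ℝ) ^ (1 / L))
    Filter.atTop

/-- The growth rate of all directed cycles of `D` with respect to `α`. -/
noncomputable def growthRate (α : E → ℝ) : ℝ :=
  D.growthRateOn Set.univ α

end Multidigraph

/-- The edge set of the subgraph `D|η`: all edges traversed by `η`-null directed
cycles of `D`. -/
def Multidigraph.nullSubgraph {V E : Type} (D : Multidigraph V E) (η : E → ℝ) : Set E :=
  { e : E | ∃ c : D.Cycle, D.weight η c = 0 ∧ D.EdgeMem e c }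

/-- `MWalk D u l v`: the word `l` is a directed walk from `u` to `v`. -/
def MWalk {V E : Type} (D : Multidigraph V E) : V → List E → V → Prop
  | u, [], v => u = v
  | u, e :: l, v => D.src e = u ∧ MWalk D (D.tgt e) l v

section walks
variable {V E : Type} {D : Multidigraph V E}

theorem MWalk.append_iff {l₁ l₂ : List E} {u v : V} :
    MWalk D u (l₁ ++ l₂) v ↔ ∃ w, MWalk D u l₁ w ∧ MWalk D w l₂ v := by
  induction l₁ generalizing u with
  | nil => simp [MWalk]
  | cons e l ih => simp [MWalk, ih, and_assoc]

theorem MWalk.end_unique {l : List E} {u v w : V} (h : MWalk D u l v) (h' : MWalk D u l w) :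
    v = w := by
  induction l generalizing u with
  | nil => exact h.symm.trans h'
  | cons e l ih => exact ih h.2 h'.2

theorem MWalk.iff_get {l : List E} (e : E) {u v : V} :
    MWalk D u (e :: l) v ↔ (∀ i (h : i + 1 < (e :: l).length),
        D.tgt ((e :: l)[i]) = D.src ((e :: l)[i+1])) ∧ D.src e = u ∧
        D.tgt ((e :: l)[l.length]) = v := by
  induction l generalizing u e with
  | nil => simp [MWalk]
  | cons f l ih =>
    rw [MWalk, ih f]
    constructor
    · rintro ⟨h1, h2, h3, h4⟩
      refine ⟨?_, h1, by simpa using h4⟩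
      intro i hi
      cases i with
      | zero => simpa using h3.symm
      | succ i => exact h2 i (by simpa using hi)
    · rintro ⟨h1, h2, h3⟩
      refine ⟨h2, ?_, ?_, by simpa using h3⟩
      · intro i hi
        exact h1 (i+1) (by simpa using hi)
      · simpa using (h1 0 (by simp)).symm

theorem isCycleWord_iff {l : List E} :
    D.IsCycleWord l ↔ l ≠ [] ∧ ∃ u, MWalk D u l u := by
  unfold Multidigraph.IsCycleWord
  refine and_congr_right fun hl => ?_
  obtain ⟨e, l, rfl⟩ := List.exists_cons_of_ne_nil hl
  constructor
  · intro h
    refine ⟨D.src e, (MWalk.iff_get e).2 ⟨?_, rfl, ?_⟩⟩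
    · intro i hi
      have := h ⟨i, by omega⟩ ⟨i+1, hi⟩ (by simpa using Nat.mod_eq_of_lt hi)
      simpa using this
    · have := h ⟨l.length, by simp⟩ ⟨0, by simp⟩ (by simp)
      simpa using this
  · rintro ⟨u, hu⟩ i j hij
    obtain ⟨h1, h2, h3⟩ := (MWalk.iff_get e).1 hu
    rcases i with ⟨i, hi⟩
    rcases j with ⟨j, hj⟩
    simp only at hij
    by_cases hi' : i + 1 < (e :: l).length
    · rw [Nat.mod_eq_of_lt hi'] at hij
      subst hij
      simpa using h1 i hi'
    · have : i = l.length := by simp at hi hi'; omega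
      subst this
      simp at hij
      subst hij
      simpa [h2] using h3

theorem MWalk.pigeon [Fintype V] {u v : V} {w : List E} (h : MWalk D u w v)
    (hl : Fintype.card V ≤ w.length) :
    ∃ a c b x, w = a ++ c ++ b ∧ c ≠ [] ∧ c.length ≤ Fintype.card V ∧ MWalk D u a x ∧
      MWalk D x c x ∧ MWalk D x b v := by
  have hx : ∀ i : Fin (Fintype.card V + 1), ∃ x, MWalk D u (w.take i) x ∧
      MWalk D x (w.drop i) v := fun i => MWalk.append_iff.1 (by simpa using h)
  choose x hx1 hx2 using hx
  have hni : ¬ Function.Injective x := fun hi => by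
    have := Fintype.card_le_of_injective x hi
    simp at this
  have : ∃ i j, i < j ∧ x i = x j := by
    simp only [Function.Injective, not_forall] at hni
    obtain ⟨i, j, hij, hne⟩ := hni
    rcases lt_or_gt_of_ne hne with h | h
    · exact ⟨i, j, h, hij⟩
    · exact ⟨j, i, h, hij.symm⟩
  obtain ⟨i, j, hij, hxx⟩ := this
  have hij' : (i : ℕ) < j := hij
  have hj := j.2
  have e1 : w.take i ++ (w.drop i).take (j - i) = w.take j := by
    have : (j : ℕ) = i + (j - i) := by omega
    conv_rhs => rw [this, List.take_add]
  have hj1 := hx1 j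
  rw [← e1] at hj1
  obtain ⟨z, hz1, hz2⟩ := MWalk.append_iff.1 hj1
  have := MWalk.end_unique hz1 (hx1 i)
  subst this
  refine ⟨w.take i, (w.drop i).take (j - i), w.drop j, x i, ?_, ?_, ?_, hx1 i, ?_, ?_⟩
  · rw [e1, List.take_append_drop]
  · intro h0
    have := congrArg List.length h0
    simp at this
    omega
  · simp; omega
  · rw [← hxx] at hz2; exact hz2
  · rw [hxx]; exact hx2 j

theorem MWalk.shorten [Fintype V] (β : E → ℝ)
    (hβ : ∀ x c, c ≠ [] → c.length ≤ Fintype.card V → MWalk D x c x → 0 ≤ (c.map β).sum)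
    (n : ℕ) : ∀ {u v : V} {w : List E}, w.length ≤ n → MWalk D u w v →
    ∃ w', MWalk D u w' v ∧ w'.length ≤ Fintype.card V ∧ (w'.map β).sum ≤ (w.map β).sum := by
  induction n with
  | zero =>
    intro u v w hn h
    exact ⟨w, h, by omega, le_rfl⟩
  | succ n ih =>
    intro u v w hn h
    by_cases hl : Fintype.card V ≤ w.length
    · obtain ⟨a, c, b, x, rfl, hc, hcl, h1, h2, h3⟩ := h.pigeon hl
      have hpos := List.length_pos_iff.2 hc
      obtain ⟨w', hw1, hw2, hw3⟩ := ih (w := a ++ b)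
        (by simp at hn ⊢; omega) (MWalk.append_iff.2 ⟨x, h1, h3⟩)
      refine ⟨w', hw1, hw2, ?_⟩
      have := hβ x c hc hcl h2
      simp at hw3 ⊢
      linarith
    · exact ⟨w, h, by omega, le_rfl⟩

theorem exists_potential [Fintype V] [Fintype E] (β : E → ℝ)
    (hβ : ∀ x c, c ≠ [] → c.length ≤ Fintype.card V → MWalk D x c x → 0 ≤ (c.map β).sum) :
    ∃ φ : V → ℝ, ∀ e, φ (D.tgt e) ≤ φ (D.src e) + β e := by
  let S : V → Set ℝ := fun v => {r | ∃ u w, MWalk D u w v ∧ (w.map β).sum = r}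
  have hfin : ((fun w : List E => (w.map β).sum) '' {w | w.length ≤ Fintype.card V}).Finite :=
    (List.finite_length_le E _).image _
  obtain ⟨B, hB⟩ := hfin.bddBelow
  have hbdd : ∀ v, BddBelow (S v) := by
    intro v
    refine ⟨B, ?_⟩
    rintro _ ⟨u, w, hw, rfl⟩
    obtain ⟨w', _, h2, h3⟩ := MWalk.shorten β hβ _ le_rfl hw
    exact (hB ⟨w', h2, rfl⟩).trans h3
  refine ⟨fun v => sInf (S v), fun e => ?_⟩
  rw [← sub_le_iff_le_add]
  refine le_csInf ⟨0, D.src e, [], rfl, by simp⟩ ?_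
  rintro _ ⟨u, w, hw, rfl⟩
  rw [sub_le_iff_le_add]
  refine csInf_le (hbdd _) ⟨u, w ++ [e], MWalk.append_iff.2 ⟨_, hw, rfl, rfl⟩, by simp⟩

theorem MWalk.telescope (φ : V → ℝ) (β : E → ℝ) {l : List E} {u v : V} (h : MWalk D u l v) :
    (l.map (fun e => β e + φ (D.src e) - φ (D.tgt e))).sum = (l.map β).sum + φ u - φ v := by
  induction l generalizing u with
  | nil => cases h; simp
  | cons e l ih =>
    obtain ⟨rfl, h⟩ := h
    simp only [List.map_cons, List.sum_cons, ih h]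
    ring

theorem weight_telescope (φ : V → ℝ) (β : E → ℝ) (c : D.Cycle) :
    D.weight (fun e => β e + φ (D.src e) - φ (D.tgt e)) c = D.weight β c := by
  induction c using Quotient.inductionOn with
  | _ l =>
    obtain ⟨u, hu⟩ := (isCycleWord_iff.1 l.2).2
    have := hu.telescope φ β
    simpa [Multidigraph.weight] using this

theorem exists_pos_lower {ι : Type*} {S : Set ι} (hS : S.Finite) (f : ι → ℝ)
    (hf : ∀ x ∈ S, 0 < f x) : ∃ m > 0, ∀ x ∈ S, m ≤ f x := by
  induction S, hS using Set.Finite.induction_on with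
  | empty => exact ⟨1, one_pos, by simp⟩
  | @insert a s _ _ ih =>
    obtain ⟨m, hm, h⟩ := ih fun x hx => hf x (Set.mem_insert_of_mem _ hx)
    refine ⟨min m (f a), lt_min hm (hf a (Set.mem_insert _ _)), ?_⟩
    rintro x (rfl | hx)
    · exact min_le_right _ _
    · exact (min_le_left _ _).trans (h x hx)

theorem sum_map_le_mul_length (f : E → ℝ) (c : ℝ) (hf : ∀ e, f e ≤ c) (l : List E) :
    (l.map f).sum ≤ c * l.length := by
  induction l with
  | nil => simp
  | cons e l ih =>
    have := hf e
    simp only [List.map_cons, List.sum_cons, List.length_cons]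
    push_cast
    linarith

theorem mul_length_le_sum_map (f : E → ℝ) (c : ℝ) (l : List E) (hf : ∀ e ∈ l, c ≤ f e) :
    c * l.length ≤ (l.map f).sum := by
  induction l with
  | nil => simp
  | cons e l ih =>
    have := hf e (by simp)
    have := ih fun x hx => hf x (by simp [hx])
    simp only [List.map_cons, List.sum_cons, List.length_cons]
    push_cast
    linarith

theorem sum_map_sub_aux (f g : E → ℝ) (l : List E) :
    (l.map (fun e => f e - g e)).sum = (l.map f).sum - (l.map g).sum := by
  induction l with
  | nil => simp
  | cons e l ih => simp only [List.map_cons, List.sum_cons, ih]; ring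

theorem exists_pot_alpha [Fintype V] [Fintype E] (α : E → ℝ)
    (hα : ∀ c : D.Cycle, 0 < D.weight α c) :
    ∃ (φ : V → ℝ) (ε : ℝ), 0 < ε ∧ ∀ e, ε ≤ α e + φ (D.src e) - φ (D.tgt e) := by
  have hfin : {l : List E | l.length ≤ Fintype.card V ∧ D.IsCycleWord l}.Finite :=
    (List.finite_length_le E _).subset fun l h => h.1
  obtain ⟨m, hm, hmin⟩ := exists_pos_lower hfin (fun l => (l.map α).sum)
    (fun l hl => hα (Quotient.mk _ ⟨l, hl.2⟩))
  have hpos : (0:ℝ) < Fintype.card V + 1 := by positivity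
  obtain ⟨φ, hφ⟩ := exists_potential (D := D) (fun e => α e - m / (Fintype.card V + 1)) (by
    intro x c hc hcl hw
    have h1 := hmin c ⟨hcl, isCycleWord_iff.2 ⟨hc, x, hw⟩⟩
    rw [sum_map_sub_aux]
    have h2 := sum_map_le_mul_length (fun _ : E => m / (Fintype.card V + 1)) _
      (fun _ => le_rfl) c
    have h3 : m / (Fintype.card V + 1) * c.length ≤ m := by
      rw [div_mul_eq_mul_div, div_le_iff₀ hpos]
      have : (c.length : ℝ) ≤ Fintype.card V := by exact_mod_cast hcl
      nlinarith
    linarith)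
  refine ⟨φ, m / (Fintype.card V + 1), by positivity, fun e => ?_⟩
  have := hφ e
  linarith

open Classical in
theorem exists_pot_eta [Fintype V] [Fintype E] (η : E → ℝ)
    (hη : ∀ c : D.Cycle, 0 ≤ D.weight η c) :
    ∃ (φ : V → ℝ) (δ : ℝ), 0 < δ ∧ (∀ e, 0 ≤ η e + φ (D.src e) - φ (D.tgt e)) ∧
      ∀ e, e ∉ D.nullSubgraph η → δ ≤ η e + φ (D.src e) - φ (D.tgt e) := by
  have hfin : {l : List E | l.length ≤ Fintype.card V ∧ 0 < (l.map η).sum}.Finite :=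
    (List.finite_length_le E _).subset fun l h => h.1
  obtain ⟨m, hm, hmin⟩ := exists_pos_lower hfin (fun l => (l.map η).sum)
    (fun l hl => hl.2)
  have hpos : (0:ℝ) < Fintype.card V + 1 := by positivity
  set δ := m / (Fintype.card V + 1) with hδ
  have hδ0 : 0 < δ := by positivity
  obtain ⟨φ, hφ⟩ := exists_potential (D := D)
    (fun e => η e - if e ∈ D.nullSubgraph η then 0 else δ) (by
    intro x c hc hcl hw
    rw [sum_map_sub_aux]
    have hcw := isCycleWord_iff.2 ⟨hc, x, hw⟩
    have h0 : 0 ≤ (c.map η).sum := hη (Quotient.mk _ ⟨c, hcw⟩)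
    rcases h0.eq_or_lt with h0 | h0
    · have hz : c.map (fun e => if e ∈ D.nullSubgraph η then 0 else δ) = c.map fun _ => 0 := by
        refine List.map_congr_left fun e he => ?_
        have : e ∈ D.nullSubgraph η := ⟨Quotient.mk _ ⟨c, hcw⟩, h0.symm, ⟨c, hcw⟩, rfl, he⟩
        simp [this]
      rw [hz, ← h0]; simp
    · have h1 := hmin c ⟨hcl, h0⟩
      have h2 := sum_map_le_mul_length (fun e => if e ∈ D.nullSubgraph η then 0 else δ) δ
        (fun e => by split_ifs <;> linarith) c
      have h3 : δ * c.length ≤ m := by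
        rw [hδ, div_mul_eq_mul_div, div_le_iff₀ hpos]
        have : (c.length : ℝ) ≤ Fintype.card V := by exact_mod_cast hcl
        nlinarith
      linarith)
  refine ⟨φ, δ, hδ0, fun e => ?_, fun e he => ?_⟩
  · have := hφ e
    split_ifs at this <;> linarith
  · have := hφ e
    rw [if_neg he] at this
    linarith

end walks

set_option linter.unusedSectionVars false

section counting
variable {V E : Type} [Fintype V] [Fintype E] {D : Multidigraph V E}

/-- walks from `u` with `n` edges and weight at most `L` -/
def WSet (D : Multidigraph V E) (β : E → ℝ) (n : ℕ) (u : V) (L : ℝ) : Set (List E) :=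
  {l | l.length = n ∧ (∃ v, MWalk D u l v) ∧ (l.map β).sum ≤ L}

theorem WSet_finite (β : E → ℝ) (n : ℕ) (u : V) (L : ℝ) : (WSet D β n u L).Finite :=
  (List.finite_length_le E n).subset fun _ h => h.1.le

open Classical in
theorem count_walks (β : E → ℝ) (h : ℝ) (h1 : 1 ≤ h) (y : V → ℝ) (y1 : ∀ u, 1 ≤ y u)
    (hA : ∀ u, ∑ e with D.src e = u, h ^ (-β e) * y (D.tgt e) ≤ y u) (n : ℕ) :
    ∀ u L, ((WSet D β n u L).ncard : ℝ) ≤ h ^ L * y u := by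
  have h0 : 0 < h := by linarith
  induction n with
  | zero =>
    intro u L
    by_cases hL : 0 ≤ L
    · have : WSet D β 0 u L ⊆ {[]} := fun l hl => List.length_eq_zero_iff.1 hl.1
      have h2 := Set.ncard_le_ncard this
      rw [Set.ncard_singleton] at h2
      have h3 : ((WSet D β 0 u L).ncard : ℝ) ≤ 1 := by exact_mod_cast h2
      have := Real.one_le_rpow h1 hL
      have := y1 u
      nlinarith
    · have : WSet D β 0 u L = ∅ := by
        ext l
        simp only [WSet, Set.mem_ofPred_eq, Set.mem_empty_iff_false, iff_false]
        rintro ⟨hl, _, hs⟩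
        rw [List.length_eq_zero_iff.1 hl] at hs
        simp at hs
        exact hL hs
      rw [this]
      have := y1 u
      simp only [Set.ncard_empty, Nat.cast_zero]
      positivity
  | succ n ih =>
    intro u L
    have hsub : WSet D β (n+1) u L ⊆
        ⋃ e ∈ Finset.univ.filter (fun e => D.src e = u),
          List.cons e '' WSet D β n (D.tgt e) (L - β e) := by
      rintro l ⟨hl, ⟨v, hv⟩, hs⟩
      cases l with
      | nil => simp at hl
      | cons e l =>
        simp only [Set.mem_iUnion]
        refine ⟨e, by simpa using hv.1, l, ⟨by simpa using hl, ⟨v, hv.2⟩, ?_⟩, rfl⟩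
        simp only [List.map_cons, List.sum_cons] at hs
        linarith
    have hfin : (⋃ e ∈ Finset.univ.filter (fun e => D.src e = u),
          List.cons e '' WSet D β n (D.tgt e) (L - β e)).Finite :=
      Set.Finite.biUnion (Finset.finite_toSet _) fun e _ => (WSet_finite _ _ _ _).image _
    have h2 := (Set.ncard_le_ncard hsub hfin).trans (Finset.set_ncard_biUnion_le _ _)
    have h3 : ((WSet D β (n+1) u L).ncard : ℝ) ≤
        ∑ e with D.src e = u, h ^ (L - β e) * y (D.tgt e) := by
      calc ((WSet D β (n+1) u L).ncard : ℝ) ≤ ∑ e with D.src e = u,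
          ((List.cons e '' WSet D β n (D.tgt e) (L - β e)).ncard : ℝ) := by exact_mod_cast h2
        _ ≤ _ := by
          refine Finset.sum_le_sum fun e _ => le_trans ?_ (ih _ _)
          exact Nat.cast_le.2 (Set.ncard_image_le (f := List.cons e) (WSet_finite β n _ _))
    refine h3.trans ?_
    calc _ = h ^ L * ∑ e with D.src e = u, h ^ (-β e) * y (D.tgt e) := by
          rw [Finset.mul_sum]
          refine Finset.sum_congr rfl fun e _ => ?_
          rw [sub_eq_add_neg, Real.rpow_add h0]; ring
      _ ≤ _ := mul_le_mul_of_nonneg_left (hA u) (by positivity)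

open Classical in
theorem count_cycles (β : E → ℝ) (ε : ℝ) (hε : 0 < ε) (hβ : ∀ e, ε ≤ β e)
    (h : ℝ) (h1 : 1 ≤ h) (y : V → ℝ) (y1 : ∀ u, 1 ≤ y u)
    (hA : ∀ u, ∑ e with D.src e = u, h ^ (-β e) * y (D.tgt e) ≤ y u) (L : ℝ) (hL : 0 ≤ L) :
    ({c : D.Cycle | D.weight β c ≤ L}.Finite) ∧
    {l : {l : List E // D.IsCycleWord l} | (l.1.map β).sum ≤ L}.Finite ∧
    ({c : D.Cycle | D.weight β c ≤ L}.ncard : ℝ) ≤ (L / ε + 1) * (∑ u, y u) * h ^ L := by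
  have h0 : 0 < h := by linarith
  set CW := {l : {l : List E // D.IsCycleWord l} | (l.1.map β).sum ≤ L} with hCW
  set F := (Finset.range (⌊L/ε⌋₊+1)) ×ˢ (Finset.univ : Finset V) with hF
  have hsub : Subtype.val '' CW ⊆ ⋃ p ∈ F, WSet D β p.1 p.2 L := by
    rintro _ ⟨l, hl, rfl⟩
    obtain ⟨u, hu⟩ := (isCycleWord_iff.1 l.2).2
    simp only [Set.mem_iUnion]
    refine ⟨(l.1.length, u), ?_, rfl, ⟨u, hu⟩, hl⟩
    have := (mul_length_le_sum_map β ε l.1 (fun e _ => hβ e)).trans hl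
    simp only [hF, Finset.mem_product, Finset.mem_range, Finset.mem_univ, and_true]
    rw [Nat.lt_succ_iff]
    refine Nat.le_floor ?_
    rw [le_div_iff₀ hε]; linarith
  have hfin : (⋃ p ∈ F, WSet D β p.1 p.2 L).Finite :=
    Set.Finite.biUnion (Finset.finite_toSet _) fun e _ => WSet_finite _ _ _ _
  have hCWf : CW.Finite := (hfin.subset hsub).of_finite_image Subtype.val_injective.injOn
  have himg : {c : D.Cycle | D.weight β c ≤ L} = Quotient.mk D.cycleSetoid '' CW := by
    ext c
    induction c using Quotient.inductionOn with
    | _ l =>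
      constructor
      · intro hl; exact ⟨l, hl, rfl⟩
      · rintro ⟨l', hl', heq⟩
        rw [← heq]; exact hl'
  refine ⟨himg ▸ hCWf.image _, hCWf, ?_⟩
  have h2 : {c : D.Cycle | D.weight β c ≤ L}.ncard ≤ ∑ p ∈ F, (WSet D β p.1 p.2 L).ncard := by
    rw [himg]
    refine (Set.ncard_image_le hCWf).trans ?_
    rw [← Set.ncard_image_of_injective CW Subtype.val_injective]
    exact (Set.ncard_le_ncard hsub hfin).trans (Finset.set_ncard_biUnion_le _ _)
  calc ({c : D.Cycle | D.weight β c ≤ L}.ncard : ℝ)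
      ≤ ∑ p ∈ F, ((WSet D β p.1 p.2 L).ncard : ℝ) := by exact_mod_cast h2
    _ ≤ ∑ p ∈ F, h ^ L * y p.2 :=
        Finset.sum_le_sum fun p _ => count_walks β h h1 y y1 hA _ _ _
    _ = ((⌊L/ε⌋₊ : ℝ) + 1) * (∑ u, y u) * h ^ L := by
        rw [hF, Finset.sum_product]
        simp only [Finset.sum_const, Finset.card_range, ← Finset.mul_sum, nsmul_eq_mul]
        push_cast; ring
    _ ≤ _ := by
        have : 0 ≤ ∑ u, y u := Finset.sum_nonneg fun u _ => by linarith [y1 u]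
        have := Nat.floor_le (show 0 ≤ L / ε by positivity)
        gcongr

theorem absorb (h h' C : ℝ) (h0 : 0 < h) (hh : h < h') :
    ∀ᶠ L : ℝ in Filter.atTop, C * (L + 1) * h ^ L ≤ h' ^ L := by
  set b := Real.log (h' / h) with hb
  have hb0 : 0 < b := Real.log_pos (by rw [lt_div_iff₀ h0]; linarith)
  have t1 := tendsto_rpow_mul_exp_neg_mul_atTop_nhds_zero 1 b hb0
  have t0 := tendsto_rpow_mul_exp_neg_mul_atTop_nhds_zero 0 b hb0
  have t := (t1.add t0).const_mul C
  have hlt := t.eventually_lt_const (show C * (0 + 0) < 1 by simp)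
  filter_upwards [hlt] with L hL
  simp only [Real.rpow_one, Real.rpow_zero, one_mul] at hL
  have e1 : h' ^ L = h ^ L * Real.exp (b * L) := by
    have : h' = h * Real.exp b := by
      rw [hb, Real.exp_log (by apply div_pos <;> linarith)]; field_simp
    rw [this, Real.mul_rpow h0.le (Real.exp_pos _).le, ← Real.exp_mul]
  rw [e1]
  have e2 : C * (L + 1) ≤ Real.exp (b * L) := by
    have hp := Real.exp_pos (b * L)
    have : C * (L * Real.exp (-b * L) + Real.exp (-b * L)) * Real.exp (b * L) = C * (L + 1) := by
      have : Real.exp (-b * L) * Real.exp (b * L) = 1 := by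
        rw [← Real.exp_add]; simp
      linear_combination (C * (L + 1)) * this
    rw [← this]
    nlinarith
  have := Real.rpow_pos_of_pos h0 L
  nlinarith

open Classical in
theorem ev_bound (E' : Set E) (β : E → ℝ) (ε : ℝ) (hε : 0 < ε) (hβ : ∀ e, ε ≤ β e)
    (h : ℝ) (h1 : 1 ≤ h) (y : V → ℝ) (y1 : ∀ u, 1 ≤ y u)
    (hA : ∀ u, ∑ e with D.src e = u, h ^ (-β e) * y (D.tgt e) ≤ y u) (h' : ℝ) (hh : h < h') :
    ∀ᶠ L : ℝ in Filter.atTop,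
      (Nat.card { c : D.Cycle | D.CycleIn E' c ∧ D.weight β c ≤ L } : ℝ) ^ (1 / L) ≤ h' := by
  filter_upwards [absorb h h' ((1 / ε + 1) * ∑ u, y u) (by linarith) hh,
    Filter.eventually_gt_atTop 0] with L hL hL0
  obtain ⟨hf, _, hc⟩ := count_cycles β ε hε hβ h h1 y y1 hA L hL0.le
  have hsub : { c : D.Cycle | D.CycleIn E' c ∧ D.weight β c ≤ L } ⊆
    {c : D.Cycle | D.weight β c ≤ L} := fun c hc => hc.2
  have h2 : (Nat.card { c : D.Cycle | D.CycleIn E' c ∧ D.weight β c ≤ L } : ℝ) ≤ h' ^ L := by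
    rw [Nat.card_coe_set_eq]
    have h3 : ({ c : D.Cycle | D.CycleIn E' c ∧ D.weight β c ≤ L }.ncard : ℝ) ≤
      {c : D.Cycle | D.weight β c ≤ L}.ncard := by exact_mod_cast Set.ncard_le_ncard hsub hf
    refine h3.trans (hc.trans (le_trans ?_ hL))
    have hy : 0 ≤ ∑ u, y u := Finset.sum_nonneg fun u _ => by linarith [y1 u]
    have : L / ε + 1 ≤ (1 / ε + 1) * (L + 1) := by
      have : 0 < 1 / ε := by positivity
      have : L / ε = 1 / ε * L := by ring
      nlinarith
    have := Real.rpow_pos_of_pos (show 0 < h by linarith) L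
    calc _ ≤ ((1 / ε + 1) * (L + 1)) * (∑ u, y u) * h ^ L := by gcongr
      _ = _ := by ring
  calc _ ≤ (h' ^ L) ^ (1 / L) := by gcongr
    _ = h' := by
      rw [← Real.rpow_mul (by linarith), mul_one_div_cancel hL0.ne', Real.rpow_one]

theorem growth_cobdd (E' : Set E) (β : E → ℝ) :
    Filter.IsCoboundedUnder (· ≤ ·) Filter.atTop (fun L : ℝ =>
      (Nat.card { c : D.Cycle | D.CycleIn E' c ∧ D.weight β c ≤ L } : ℝ) ^ (1 / L)) :=
  Filter.IsBoundedUnder.isCoboundedUnder_le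
    ⟨0, Filter.eventually_map.2 (Filter.Eventually.of_forall fun L => by positivity)⟩

open Classical in
theorem exists_trivial_y (β : E → ℝ) (ε : ℝ) (hε : 0 < ε) (hβ : ∀ e, ε ≤ β e) :
    ∃ h : ℝ, 1 ≤ h ∧ ∀ u, ∑ e with D.src e = u, h ^ (-β e) * 1 ≤ 1 := by
  have t := (tendsto_rpow_neg_atTop hε).const_mul (Fintype.card E : ℝ)
  have hlt := t.eventually_lt_const (show (Fintype.card E : ℝ) * 0 < 1 by simp)
  obtain ⟨h, hh, h1⟩ := (hlt.and (Filter.eventually_ge_atTop 1)).exists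
  refine ⟨h, h1, fun u => ?_⟩
  calc ∑ e with D.src e = u, h ^ (-β e) * 1 ≤ ∑ e with D.src e = u, h ^ (-ε) := by
        refine Finset.sum_le_sum fun e _ => ?_
        rw [mul_one]
        exact Real.rpow_le_rpow_of_exponent_le h1 (by linarith [hβ e])
    _ ≤ ∑ e : E, h ^ (-ε) := by
        refine Finset.sum_le_sum_of_subset_of_nonneg (Finset.filter_subset _ _) ?_
        intros; positivity
    _ ≤ 1 := by simpa using hh.le

theorem growth_bdd (E' : Set E) (β : E → ℝ) (ε : ℝ) (hε : 0 < ε) (hβ : ∀ e, ε ≤ β e) :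
    Filter.IsBoundedUnder (· ≤ ·) Filter.atTop (fun L : ℝ =>
      (Nat.card { c : D.Cycle | D.CycleIn E' c ∧ D.weight β c ≤ L } : ℝ) ^ (1 / L)) := by
  obtain ⟨h, h1, hy⟩ := exists_trivial_y (D := D) β ε hε hβ
  exact ⟨h + 1, Filter.eventually_map.2
    (ev_bound E' β ε hε hβ h h1 (fun _ => 1) (fun _ => le_rfl) hy (h+1) (by linarith))⟩

theorem cycles_finite (β : E → ℝ) (ε : ℝ) (hε : 0 < ε) (hβ : ∀ e, ε ≤ β e) (L : ℝ)
    (hL : 0 ≤ L) : ({c : D.Cycle | D.weight β c ≤ L}.Finite) ∧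
    {l : {l : List E // D.IsCycleWord l} | (l.1.map β).sum ≤ L}.Finite := by
  obtain ⟨h, h1, hy⟩ := exists_trivial_y (D := D) β ε hε hβ
  obtain ⟨a, b, _⟩ := count_cycles β ε hε hβ h h1 (fun _ => 1) (fun _ => le_rfl) hy L hL
  exact ⟨a, b⟩

open Classical in
theorem growth_le (E' : Set E) (β : E → ℝ) (ε : ℝ) (hε : 0 < ε) (hβ : ∀ e, ε ≤ β e)
    (h : ℝ) (h1 : 1 ≤ h) (y : V → ℝ) (y1 : ∀ u, 1 ≤ y u)
    (hA : ∀ u, ∑ e with D.src e = u, h ^ (-β e) * y (D.tgt e) ≤ y u) :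
    D.growthRateOn E' β ≤ h := by
  refine le_of_forall_gt_imp_ge_of_dense fun h' hh => ?_
  exact Filter.limsup_le_of_le (growth_cobdd E' β)
    (ev_bound E' β ε hε hβ h h1 y y1 hA h' hh)

end counting

section super
variable {V E : Type} [Fintype V] [Fintype E] {D : Multidigraph V E}

theorem walk_return (N : Set E)
    (hret : ∀ e ∈ N, ∃ p, MWalk D (D.tgt e) p (D.src e) ∧ ∀ f ∈ p, f ∈ N) {w : List E}
    {u v : V} (hw : MWalk D u w v) (hN : ∀ f ∈ w, f ∈ N) :
    ∃ r, MWalk D v r u ∧ ∀ f ∈ r, f ∈ N := by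
  induction w generalizing u with
  | nil => exact ⟨[], hw.symm, by simp⟩
  | cons e w ih =>
    obtain ⟨r, hr, hrN⟩ := ih hw.2 fun f hf => hN f (by simp [hf])
    obtain ⟨p, hp, hpN⟩ := hret e (hN e (by simp))
    refine ⟨r ++ p, MWalk.append_iff.2 ⟨_, hr, hw.1 ▸ hp⟩, ?_⟩
    intro f hf
    rcases List.mem_append.1 hf with hf | hf
    · exact hrN f hf
    · exact hpN f hf

/-- closed words in `N` of weight at most `L` -/
def NClosed (D : Multidigraph V E) (N : Set E) (α : E → ℝ) (L : ℝ) :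
    Set {l : List E // D.IsCycleWord l} :=
  {l | (∀ e ∈ l.1, e ∈ N) ∧ (l.1.map α).sum ≤ L}

theorem cycleIn_mk {N : Set E} {l : {l : List E // D.IsCycleWord l}} :
    D.CycleIn N (Quotient.mk D.cycleSetoid l) ↔ ∀ e ∈ l.1, e ∈ N := by
  constructor
  · intro h e he
    exact h e ⟨l, rfl, he⟩
  · rintro h e ⟨l', hl', he⟩
    have : List.IsRotated l'.1 l.1 := Quotient.exact hl'
    exact h e (this.mem_iff.1 he)

theorem NClosed_card (N : Set E) (α : E → ℝ) (ε : ℝ) (hε : 0 < ε) (hα : ∀ e, ε ≤ α e)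
    (L : ℝ) (hL : 0 ≤ L) :
    ((NClosed D N α L).ncard : ℝ) ≤ (L / ε + 1) *
      (Nat.card { c : D.Cycle | D.CycleIn N c ∧ D.weight α c ≤ L } : ℝ) := by
  set S := { c : D.Cycle | D.CycleIn N c ∧ D.weight α c ≤ L } with hS
  have hSf : S.Finite := (cycles_finite α ε hε hα L hL).1.subset fun c hc => hc.2
  have hk : ∀ l : {l : List E // D.IsCycleWord l}, ∃ k, k < l.1.length ∧
      (Quotient.out (Quotient.mk D.cycleSetoid l)).1.rotate k = l.1 := by
    intro l
    have h1 : List.IsRotated (Quotient.out (Quotient.mk D.cycleSetoid l)).1 l.1 :=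
      Quotient.exact (Quotient.out_eq (Quotient.mk D.cycleSetoid l))
    obtain ⟨n, hn⟩ := h1
    refine ⟨n % l.1.length, Nat.mod_lt _ (List.length_pos_iff.2 l.2.1), ?_⟩
    have : l.1.length = (Quotient.out (Quotient.mk D.cycleSetoid l)).1.length := by
      rw [← hn, List.length_rotate]
    rw [this, List.rotate_mod, hn]
  choose k hk1 hk2 using hk
  have hT : (Set.Iio (⌊L/ε⌋₊ + 1)).Finite := Set.finite_Iio _
  have key := Set.ncard_le_ncard_of_injOn (s := NClosed D N α L)
    (t := S ×ˢ Set.Iio (⌊L/ε⌋₊ + 1))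
    (fun l => ((Quotient.mk D.cycleSetoid l : D.Cycle), k l)) (by
      intro l hl
      refine ⟨⟨cycleIn_mk.2 hl.1, hl.2⟩, ?_⟩
      have h1 := (mul_length_le_sum_map α ε l.1 (fun e _ => hα e)).trans hl.2
      have h2 : l.1.length ≤ ⌊L/ε⌋₊ := by
        refine Nat.le_floor ?_
        rw [le_div_iff₀ hε]; linarith
      have h3 := hk1 l
      simp only [Set.mem_Iio]
      omega) (by
      intro l _ l' _ heq
      have h1 := congrArg Prod.fst heq
      have h2 := congrArg Prod.snd heq
      simp only at h1 h2
      apply Subtype.ext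
      rw [← hk2 l, ← hk2 l', h2, h1]) (hSf.prod hT)
  rw [Set.ncard_prod] at key
  have h4 : (Set.Iio (⌊L/ε⌋₊ + 1)).ncard = ⌊L/ε⌋₊ + 1 := by
    rw [← Finset.coe_Iio, Set.ncard_coe_finset]; simp
  rw [h4] at key
  rw [Nat.card_coe_set_eq]
  have key' : ((NClosed D N α L).ncard : ℝ) ≤ S.ncard * (⌊L/ε⌋₊ + 1) := by exact_mod_cast key
  refine key'.trans ?_
  rw [mul_comm]
  have := Nat.floor_le (show 0 ≤ L / ε by positivity)
  gcongr

/-- nonempty walks from `u` in `N` of weight at most `L` -/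
def NW (D : Multidigraph V E) (N : Set E) (α : E → ℝ) (u : V) (L : ℝ) : Set (List E) :=
  {w | w ≠ [] ∧ (∃ v, MWalk D u w v) ∧ (∀ f ∈ w, f ∈ N) ∧ (w.map α).sum ≤ L}

theorem NW_card (N : Set E) (α : E → ℝ) (ε : ℝ) (hε : 0 < ε) (hα : ∀ e, ε ≤ α e)
    (hret : ∀ e ∈ N, ∃ p, MWalk D (D.tgt e) p (D.src e) ∧ ∀ f ∈ p, f ∈ N) :
    ∃ C : ℝ, 0 ≤ C ∧ ∀ u L, 0 ≤ L → (NW D N α u L).Finite ∧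
      ((NW D N α u L).ncard : ℝ) ≤ Fintype.card V * (NClosed D N α (L + C)).ncard := by
  have hR : ∀ u v, ∃ r, (∃ r', MWalk D v r' u ∧ ∀ f ∈ r', f ∈ N) →
      MWalk D v r u ∧ ∀ f ∈ r, f ∈ N := by
    intro u v
    by_cases h : ∃ r', MWalk D v r' u ∧ ∀ f ∈ r', f ∈ N
    · obtain ⟨r, hr⟩ := h
      exact ⟨r, fun _ => hr⟩
    · exact ⟨[], fun h' => absurd h' h⟩
  choose R hR using hR
  obtain ⟨C, hC⟩ := (Set.finite_range fun p : V × V => ((R p.1 p.2).map α).sum).bddAbove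
  refine ⟨max C 0, le_max_right _ _, fun u L hL => ?_⟩
  have hend : ∀ w, ∃ v, (∃ v', MWalk D u w v') → MWalk D u w v := by
    intro w
    by_cases h : ∃ v', MWalk D u w v'
    · obtain ⟨v, hv⟩ := h
      exact ⟨v, fun _ => hv⟩
    · exact ⟨u, fun h' => absurd h' h⟩
  choose en hen using hend
  have hfinC : (NClosed D N α (L + max C 0)).Finite :=
    (cycles_finite α ε hε hα _ (by positivity)).2.subset fun l hl => hl.2
  have hmaps : ∀ w ∈ NW D N α u L, (fun w => (en w, w ++ R u (en w))) w ∈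
      (Set.univ : Set V) ×ˢ (Subtype.val '' NClosed D N α (L + max C 0)) := by
    rintro w ⟨hw0, hw1, hwN, hws⟩
    refine ⟨trivial, ?_⟩
    have h1 := hen w hw1
    obtain ⟨h2, h3⟩ := hR u (en w) (walk_return N hret h1 hwN)
    refine ⟨⟨w ++ R u (en w), isCycleWord_iff.2 ⟨by simp [hw0], u,
      MWalk.append_iff.2 ⟨_, h1, h2⟩⟩⟩, ⟨?_, ?_⟩, rfl⟩
    · intro f hf
      rcases List.mem_append.1 hf with hf | hf
      · exact hwN f hf
      · exact h3 f hf
    · have : ((R u (en w)).map α).sum ≤ C := hC ⟨(u, en w), rfl⟩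
      have := le_max_left C 0
      simp only [List.map_append, List.sum_append]
      linarith
  have hinj : Set.InjOn (fun w => (en w, w ++ R u (en w))) (NW D N α u L) := by
    intro w _ w' _ heq
    simp only [Prod.mk.injEq] at heq
    obtain ⟨h1, h2⟩ := heq
    rw [h1] at h2
    exact List.append_cancel_right h2
  have hfinT : ((Set.univ : Set V) ×ˢ
      (Subtype.val '' NClosed D N α (L + max C 0))).Finite :=
    Set.finite_univ.prod (hfinC.image _)
  refine ⟨Set.Finite.of_injOn (fun w hw => hmaps w hw) hinj hfinT, ?_⟩
  have key := Set.ncard_le_ncard_of_injOn _ hmaps hinj hfinT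
  rw [Set.ncard_prod, Set.ncard_image_of_injective _ Subtype.val_injective, Set.ncard_univ,
    Nat.card_eq_fintype_card] at key
  exact_mod_cast key

theorem NW_growth (N : Set E) (α : E → ℝ) (ε : ℝ) (hε : 0 < ε) (hα : ∀ e, ε ≤ α e)
    (hret : ∀ e ∈ N, ∃ p, MWalk D (D.tgt e) p (D.src e) ∧ ∀ f ∈ p, f ∈ N)
    (h2 : ℝ) (hg1 : 1 < D.growthRateOn N α) (hg : D.growthRateOn N α < h2) :
    ∃ L0 : ℝ, 0 ≤ L0 ∧ ∀ L, L0 ≤ L → ∀ u, (NW D N α u L).Finite ∧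
      ((NW D N α u L).ncard : ℝ) ≤ h2 ^ L := by
  obtain ⟨C, hC0, hC⟩ := NW_card (D := D) N α ε hε hα hret
  obtain ⟨h1, hgh1, hh12⟩ := exists_between hg
  have h10 : 0 < h1 := by linarith
  have ev : ∀ᶠ L : ℝ in Filter.atTop,
      (Nat.card { c : D.Cycle | D.CycleIn N c ∧ D.weight α c ≤ L } : ℝ) ^ (1 / L) < h1 :=
    Filter.eventually_lt_of_limsup_lt hgh1 (growth_bdd N α ε hε hα)
  have ev2 := (Filter.tendsto_atTop_add_const_right Filter.atTop C Filter.tendsto_id).eventually ev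
  have ev3 := absorb h1 h2 (Fintype.card V * ((1 + C) / ε + 1) * h1 ^ C) h10 hh12
  obtain ⟨L0, hL0⟩ := Filter.eventually_atTop.1
    (ev2.and (ev3.and (Filter.eventually_gt_atTop 0)))
  refine ⟨max L0 0, le_max_right _ _, fun L hL u => ?_⟩
  obtain ⟨e2, e3, hLp⟩ := hL0 L ((le_max_left _ _).trans hL)
  obtain ⟨hf, hc⟩ := hC u L hLp.le
  refine ⟨hf, hc.trans (le_trans ?_ e3)⟩
  have hLC : 0 < L + C := by linarith
  have h4 := NClosed_card (D := D) N α ε hε hα (L + C) hLC.le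
  simp only [id] at e2
  set K : ℝ := (Nat.card { c : D.Cycle | D.CycleIn N c ∧ D.weight α c ≤ L + C } : ℝ) with hK
  have hK0 : 0 ≤ K := by positivity
  have h5 : K ≤ h1 ^ (L + C) := by
    calc K = (K ^ (1 / (L + C))) ^ (L + C) := by
          rw [← Real.rpow_mul hK0, one_div_mul_cancel hLC.ne', Real.rpow_one]
      _ ≤ h1 ^ (L + C) := by gcongr
  rw [Real.rpow_add h10] at h5
  have h6 : (L + C) / ε + 1 ≤ ((1 + C) / ε + 1) * (L + 1) := by
    rw [div_add_one hε.ne', div_add_one hε.ne', div_mul_eq_mul_div]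
    gcongr
    nlinarith [mul_nonneg hC0 hLp.le]
  have : 0 < (L + C) / ε + 1 := by positivity
  calc (Fintype.card V : ℝ) * (NClosed D N α (L + C)).ncard
      ≤ Fintype.card V * ((((1 + C) / ε + 1) * (L + 1)) * (h1 ^ L * h1 ^ C)) := by
        gcongr
        refine h4.trans ?_
        gcongr
    _ = _ := by ring

/-- walks in `N` from `u` with `n` edges -/
def NWn (D : Multidigraph V E) (N : Set E) (n : ℕ) (u : V) : Set (List E) :=
  {w | w.length = n ∧ (∃ v, MWalk D u w v) ∧ (∀ f ∈ w, f ∈ N)}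

theorem NWn_finite (N : Set E) (n : ℕ) (u : V) : (NWn D N n u).Finite :=
  (List.finite_length_le E n).subset fun _ h => h.1.le

/-- weighted count of walks in `N` from `u` with `n` edges -/
noncomputable def FW (D : Multidigraph V E) (N : Set E) (α : E → ℝ) (h : ℝ) (n : ℕ) (u : V) : ℝ :=
  ∑ w ∈ (NWn_finite (D := D) N n u).toFinset, h ^ (-(w.map α).sum)

open Classical in
theorem FW_succ (N : Set E) (α : E → ℝ) (h : ℝ) (h0 : 0 < h) (n : ℕ) (u : V) :
    ∑ e with D.src e = u ∧ e ∈ N, h ^ (-α e) * FW D N α h n (D.tgt e) = FW D N α h (n+1) u := by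
  unfold FW
  simp only [Finset.mul_sum]
  rw [Finset.sum_sigma']
  refine Finset.sum_bij (fun p _ => p.1 :: p.2) ?_ ?_ ?_ ?_
  · rintro ⟨e, w⟩ hp
    simp only [Finset.mem_sigma, Finset.mem_filter, Finset.mem_univ, true_and,
      Set.Finite.mem_toFinset] at hp ⊢
    obtain ⟨⟨h1, h2⟩, h3, ⟨v, h4⟩, h5⟩ := hp
    exact ⟨by simp [h3], ⟨v, h1, h4⟩, by simpa using ⟨h2, h5⟩⟩
  · rintro ⟨e, w⟩ _ ⟨e', w'⟩ _ heq
    simp only [List.cons.injEq] at heq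
    obtain ⟨rfl, rfl⟩ := heq
    rfl
  · intro w hw
    simp only [Set.Finite.mem_toFinset] at hw
    obtain ⟨h1, ⟨v, h2⟩, h3⟩ := hw
    cases w with
    | nil => simp at h1
    | cons e w =>
      refine ⟨⟨e, w⟩, ?_, rfl⟩
      simp only [Finset.mem_sigma, Finset.mem_filter, Finset.mem_univ, true_and,
        Set.Finite.mem_toFinset]
      exact ⟨⟨h2.1, h3 e (by simp)⟩, by simpa using h1, ⟨v, h2.2⟩,
        fun f hf => h3 f (by simp [hf])⟩
  · rintro ⟨e, w⟩ _
    simp only [List.map_cons, List.sum_cons]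
    rw [neg_add, Real.rpow_add h0]

theorem FW_zero (N : Set E) (α : E → ℝ) (h : ℝ) (u : V) : FW D N α h 0 u = 1 := by
  have : (NWn_finite (D := D) N 0 u).toFinset = {[]} := by
    ext w
    simp only [Set.Finite.mem_toFinset, Finset.mem_singleton]
    constructor
    · intro hw; exact List.length_eq_zero_iff.1 hw.1
    · rintro rfl; exact ⟨rfl, ⟨u, rfl⟩, by simp⟩
  unfold FW
  rw [this]
  simp

theorem FW_nonneg (N : Set E) (α : E → ℝ) (h : ℝ) (h0 : 0 < h) (n : ℕ) (u : V) :
    0 ≤ FW D N α h n u := Finset.sum_nonneg fun _ _ => by positivity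

theorem FW_small (N : Set E) (α : E → ℝ) (ε : ℝ) (hε : 0 < ε) (hα : ∀ e, ε ≤ α e)
    (hret : ∀ e ∈ N, ∃ p, MWalk D (D.tgt e) p (D.src e) ∧ ∀ f ∈ p, f ∈ N)
    (h : ℝ) (hg1 : 1 < D.growthRateOn N α) (hg : D.growthRateOn N α < h) :
    ∃ n, 1 ≤ n ∧ ∀ u, FW D N α h n u ≤ 1 / 2 := by
  obtain ⟨h2, hgh2, hh2⟩ := exists_between hg
  have h20 : 0 < h2 := by linarith
  have h0 : 0 < h := by linarith
  obtain ⟨L0, hL00, hL0⟩ := NW_growth (D := D) N α ε hε hα hret h2 hg1 hgh2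
  have hsum : Summable fun k : ℕ => h2 * (h2 / h) ^ k :=
    (summable_geometric_of_lt_one (by positivity) (by rw [div_lt_one h0]; exact hh2)).mul_left _
  obtain ⟨s, hs⟩ := summable_iff_vanishing_norm.1 hsum (1/2) (by norm_num)
  set k0 : ℕ := max (s.sup id + 1) ⌈L0⌉₊ with hk0
  obtain ⟨n, hn⟩ := exists_nat_ge ((k0 : ℝ) / ε)
  have hk0pos : 1 ≤ k0 := (Nat.le_add_left 1 _).trans (le_max_left _ _)
  have hn' : (k0 : ℝ) ≤ ε * n := by rw [div_le_iff₀ hε] at hn; linarith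
  have hn1 : 1 ≤ n := by
    rcases Nat.eq_zero_or_pos n with h | h
    · subst h
      have : (1:ℝ) ≤ k0 := by exact_mod_cast hk0pos
      simp at hn'
      omega
    · exact h
  refine ⟨n, hn1, fun u => ?_⟩
  set W := (NWn_finite (D := D) N n u).toFinset with hW
  have hWm : ∀ w ∈ W, (k0 : ℝ) ≤ (w.map α).sum := by
    intro w hw
    rw [hW, Set.Finite.mem_toFinset] at hw
    have := mul_length_le_sum_map α ε w (fun e _ => hα e)
    rw [hw.1] at this
    linarith
  classical
  set T := W.image (fun w => ⌊(w.map α).sum⌋₊) with hT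
  have hTk : ∀ k ∈ T, k0 ≤ k := by
    intro k hk
    obtain ⟨w, hw, rfl⟩ := Finset.mem_image.1 hk
    exact Nat.le_floor (hWm w hw)
  have hdis : Disjoint T s := by
    rw [Finset.disjoint_left]
    intro k hk hks
    have h1 := hTk k hk
    have h3 : k ≤ s.sup id := Finset.le_sup (f := id) hks
    have h4 := le_max_left (s.sup id + 1) ⌈L0⌉₊
    omega
  have hlt := hs T hdis
  rw [Real.norm_eq_abs] at hlt
  refine le_trans ?_ (le_of_lt (lt_of_le_of_lt (le_abs_self _) hlt))
  unfold FW
  rw [← Finset.sum_fiberwise_of_maps_to (t := T) (g := fun w => ⌊(w.map α).sum⌋₊)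
    (fun w hw => Finset.mem_image_of_mem _ hw)]
  refine Finset.sum_le_sum fun k hk => ?_
  have hkL : L0 ≤ (k : ℝ) + 1 := by
    have h1 : (⌈L0⌉₊ : ℝ) ≤ k := by exact_mod_cast (le_max_right _ _).trans (hTk k hk)
    have := Nat.le_ceil L0
    linarith
  obtain ⟨hf, hc⟩ := hL0 _ hkL u
  have hsub : ((W.filter fun w => ⌊(w.map α).sum⌋₊ = k : Finset (List E)) : Set (List E)) ⊆
      NW D N α u (k + 1) := by
    intro w hw
    simp only [Finset.coe_filter, Set.mem_ofPred_eq] at hw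
    obtain ⟨hw1, rfl⟩ := hw
    rw [hW, Set.Finite.mem_toFinset] at hw1
    refine ⟨?_, hw1.2.1, hw1.2.2, (Nat.lt_floor_add_one _).le⟩
    rintro rfl
    have := hw1.1
    simp at this
    omega
  have hcard := Set.ncard_le_ncard hsub hf
  rw [Set.ncard_coe_finset] at hcard
  have hcard' : ((W.filter fun w => ⌊(w.map α).sum⌋₊ = k).card : ℝ) ≤ h2 ^ ((k : ℝ) + 1) :=
    le_trans (by exact_mod_cast hcard) hc
  calc ∑ w ∈ W with ⌊(w.map α).sum⌋₊ = k, h ^ (-(w.map α).sum)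
      ≤ ∑ w ∈ W with ⌊(w.map α).sum⌋₊ = k, h ^ (-(k : ℝ)) := by
        refine Finset.sum_le_sum fun w hw => ?_
        rw [Finset.mem_filter] at hw
        refine Real.rpow_le_rpow_of_exponent_le (by linarith) (neg_le_neg ?_)
        rw [← hw.2]
        exact Nat.floor_le ((Nat.cast_nonneg _).trans (hWm w hw.1))
    _ = ((W.filter fun w => ⌊(w.map α).sum⌋₊ = k).card : ℝ) * h ^ (-(k : ℝ)) := by
        rw [Finset.sum_const, nsmul_eq_mul]
    _ ≤ h2 ^ ((k : ℝ) + 1) * h ^ (-(k : ℝ)) := by gcongr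
    _ = h2 * (h2 / h) ^ k := by
        rw [Real.rpow_add h20, Real.rpow_neg h0.le, Real.rpow_natCast, Real.rpow_natCast,
          Real.rpow_one, div_pow]
        field_simp

open Classical in
theorem exists_super (N : Set E) (α : E → ℝ) (ε : ℝ) (hε : 0 < ε) (hα : ∀ e, ε ≤ α e)
    (hret : ∀ e ∈ N, ∃ p, MWalk D (D.tgt e) p (D.src e) ∧ ∀ f ∈ p, f ∈ N)
    (h : ℝ) (hg1 : 1 < D.growthRateOn N α) (hg : D.growthRateOn N α < h) :
    ∃ y : V → ℝ, (∀ u, 1 ≤ y u) ∧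
      ∀ u, ∑ e with D.src e = u ∧ e ∈ N, h ^ (-α e) * y (D.tgt e) ≤ y u - 1 / 2 := by
  have h0 : 0 < h := by linarith
  obtain ⟨n, hn, hF⟩ := FW_small (D := D) N α ε hε hα hret h hg1 hg
  refine ⟨fun u => ∑ k ∈ Finset.range n, FW D N α h k u, fun u => ?_, fun u => ?_⟩
  · rw [← FW_zero (D := D) N α h u]
    exact Finset.single_le_sum (f := fun k => FW D N α h k u)
      (fun k _ => FW_nonneg N α h h0 k u) (Finset.mem_range.2 hn)
  · have : ∑ e with D.src e = u ∧ e ∈ N, h ^ (-α e) *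
        (∑ k ∈ Finset.range n, FW D N α h k (D.tgt e)) =
        ∑ k ∈ Finset.range n, FW D N α h (k+1) u := by
      simp only [Finset.mul_sum]
      rw [Finset.sum_comm]
      exact Finset.sum_congr rfl fun k _ => FW_succ N α h h0 k u
    simp only
    rw [this]
    have h1 := Finset.sum_range_succ (fun k => FW D N α h k u) n
    have h2 := Finset.sum_range_succ' (fun k => FW D N α h k u) n
    have h3 := FW_zero (D := D) N α h u
    have h4 := hF u
    linarith

end super

section final
variable {V E : Type} [Fintype V] [Fintype E] {D : Multidigraph V E}

theorem growth_congr (E' : Set E) (β β' : E → ℝ) (hw : ∀ c, D.weight β c = D.weight β' c) :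
    D.growthRateOn E' β = D.growthRateOn E' β' := by
  unfold Multidigraph.growthRateOn
  simp only [hw]

theorem null_edge_zero (η η' : E → ℝ) (hw : ∀ c, D.weight η' c = D.weight η c)
    (h0 : ∀ e, 0 ≤ η' e) (e : E) (he : e ∈ D.nullSubgraph η) : η' e = 0 := by
  obtain ⟨c, hc, l, rfl, hel⟩ := he
  have hc' : (l.1.map η').sum = 0 := (hw (Quotient.mk D.cycleSetoid l)).trans hc
  refine le_antisymm ?_ (h0 e)
  rw [← hc']
  refine List.single_le_sum ?_ _ (List.mem_map_of_mem hel)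
  intro x hx
  obtain ⟨f, _, rfl⟩ := List.mem_map.1 hx
  exact h0 f

theorem null_return (η : E → ℝ) (e : E) (he : e ∈ D.nullSubgraph η) :
    ∃ p, MWalk D (D.tgt e) p (D.src e) ∧ ∀ f ∈ p, f ∈ D.nullSubgraph η := by
  obtain ⟨c, hc, l, rfl, hel⟩ := he
  obtain ⟨u, hu⟩ := (isCycleWord_iff.1 l.2).2
  obtain ⟨s, t, hst⟩ := List.append_of_mem hel
  rw [hst] at hu
  obtain ⟨x, h1, h2, h3⟩ := MWalk.append_iff.1 hu
  refine ⟨t ++ s, MWalk.append_iff.2 ⟨u, h3, h2 ▸ h1⟩, fun f hf => ?_⟩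
  refine ⟨_, hc, l, rfl, ?_⟩
  rw [hst]
  rcases List.mem_append.1 hf with hf | hf <;> simp [hf]

theorem weight_null (N : Set E) (η' : E → ℝ) (h0 : ∀ e ∈ N, η' e = 0) (c : D.Cycle)
    (hc : D.CycleIn N c) : D.weight η' c = 0 := by
  induction c using Quotient.inductionOn with
  | _ l =>
    have hl := cycleIn_mk.1 hc
    change (l.1.map η').sum = 0
    refine List.sum_eq_zero fun x hx => ?_
    obtain ⟨f, hf, rfl⟩ := List.mem_map.1 hx
    exact h0 f (hl f hf)

theorem weight_add_mul (α η : E → ℝ) (t : ℝ) (c : D.Cycle) :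
    D.weight (fun e => α e + t * η e) c = D.weight α c + t * D.weight η c := by
  induction c using Quotient.inductionOn with
  | _ l =>
    change (l.1.map _).sum = (l.1.map α).sum + t * (l.1.map η).sum
    induction l.1 with
    | nil => simp
    | cons e l ih => simp only [List.map_cons, List.sum_cons, ih]; ring

theorem growth_lower (N : Set E) (α η : E → ℝ) (ε : ℝ) (hε : 0 < ε) (hα : ∀ e, ε ≤ α e)
    (hη : ∀ e, 0 ≤ η e) (hN : ∀ e ∈ N, η e = 0) (t : ℝ) (ht : 0 ≤ t) :
    D.growthRateOn N α ≤ D.growthRate (fun e => α e + t * η e) := by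
  have hβ : ∀ e, ε ≤ α e + t * η e := fun e => by
    have := hα e
    have := mul_nonneg ht (hη e)
    linarith
  refine Filter.limsup_le_limsup ?_ (growth_cobdd N α) (growth_bdd Set.univ _ ε hε hβ)
  filter_upwards [Filter.eventually_gt_atTop 0] with L hL
  have hsub : { c : D.Cycle | D.CycleIn N c ∧ D.weight α c ≤ L } ⊆
      { c : D.Cycle | D.CycleIn Set.univ c ∧ D.weight (fun e => α e + t * η e) c ≤ L } := by
    rintro c ⟨h1, h2⟩
    refine ⟨fun e _ => trivial, ?_⟩
    rw [weight_add_mul, weight_null N η hN c h1]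
    simpa using h2
  have hfin : { c : D.Cycle | D.CycleIn Set.univ c ∧
      D.weight (fun e => α e + t * η e) c ≤ L }.Finite :=
    (cycles_finite _ ε hε hβ L hL.le).1.subset fun c hc => hc.2
  have := Set.ncard_le_ncard hsub hfin
  simp only [Nat.card_coe_set_eq]
  gcongr

open Classical in
theorem growth_upper (N : Set E) (α η : E → ℝ) (ε : ℝ) (hε : 0 < ε) (hα : ∀ e, ε ≤ α e)
    (hη : ∀ e, 0 ≤ η e) (δ : ℝ) (hδ : 0 < δ) (hN : ∀ e, e ∉ N → δ ≤ η e)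
    (hret : ∀ e ∈ N, ∃ p, MWalk D (D.tgt e) p (D.src e) ∧ ∀ f ∈ p, f ∈ N)
    (h : ℝ) (hg1 : 1 < D.growthRateOn N α) (hg : D.growthRateOn N α < h) :
    ∀ᶠ t : ℝ in Filter.atTop, D.growthRate (fun e => α e + t * η e) ≤ h := by
  have h1 : 1 < h := by linarith
  have h0 : 0 < h := by linarith
  obtain ⟨y, y1, hy⟩ := exists_super (D := D) N α ε hε hα hret h hg1 hg
  have y0 : ∀ u, 0 ≤ y u := fun u => by linarith [y1 u]
  have htend : Filter.Tendsto (fun t : ℝ => (∑ e, y (D.tgt e)) * h ^ (-(δ * t)))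
      Filter.atTop (nhds ((∑ e, y (D.tgt e)) * 0)) := by
    refine Filter.Tendsto.const_mul _ ?_
    have h2 : (fun t : ℝ => h ^ (-(δ * t))) = fun t => Real.exp (-(Real.log h * δ * t)) := by
      funext t
      rw [Real.rpow_def_of_pos h0]
      ring_nf
    rw [h2]
    refine Real.tendsto_exp_neg_atTop_nhds_zero.comp ?_
    exact Filter.Tendsto.const_mul_atTop (mul_pos (Real.log_pos h1) hδ) Filter.tendsto_id
  have hlt := htend.eventually_lt_const (show (∑ e, y (D.tgt e)) * 0 < 1 / 2 by simp)
  filter_upwards [hlt, Filter.eventually_ge_atTop 0] with t ht ht0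
  have hβ : ∀ e, α e ≤ α e + t * η e := fun e => by
    have := mul_nonneg ht0 (hη e)
    linarith
  refine growth_le Set.univ _ ε hε (fun e => (hα e).trans (hβ e)) h h1.le y y1 fun u => ?_
  rw [← Finset.sum_filter_add_sum_filter_not _ (fun e => e ∈ N), Finset.filter_filter,
    Finset.filter_filter]
  have p1 : ∑ e with D.src e = u ∧ e ∈ N, h ^ (-(α e + t * η e)) * y (D.tgt e) ≤ y u - 1 / 2 := by
    refine le_trans (Finset.sum_le_sum fun e _ => ?_) (hy u)
    refine mul_le_mul_of_nonneg_right ?_ (y0 _)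
    exact Real.rpow_le_rpow_of_exponent_le h1.le (neg_le_neg (hβ e))
  have p2 : ∑ e with D.src e = u ∧ e ∉ N, h ^ (-(α e + t * η e)) * y (D.tgt e) ≤ 1 / 2 := by
    refine le_trans ?_ ht.le
    rw [Finset.sum_mul]
    calc _ ≤ ∑ e with D.src e = u ∧ e ∉ N, y (D.tgt e) * h ^ (-(δ * t)) := by
          refine Finset.sum_le_sum fun e he => ?_
          rw [mul_comm]
          refine mul_le_mul_of_nonneg_left ?_ (y0 _)
          refine Real.rpow_le_rpow_of_exponent_le h1.le (neg_le_neg ?_)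
          have h3 := hN e (Finset.mem_filter.1 he).2.2
          have h4 := hα e
          nlinarith
      _ ≤ _ := Finset.sum_le_sum_of_subset_of_nonneg (Finset.subset_univ _) fun e _ _ =>
          mul_nonneg (y0 _) (by positivity)
  linarith

end final

/-- Let `α` be an edge weighting of `D` positive on every directed
cycle and `η` an edge weighting nonnegative on every directed cycle, and let `D|η` be
the subgraph of edges traversed by `η`-null directed cycles.  Then (a) every directed
cycle of `D|η` is `η`-null, and (b) if `gr_{D|η}(α) > 1`, then for every `t ≥ 0` the
weighting `α + t·η` is positive on every directed cycle of `D` and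
`gr_D(α + t·η) ≥ gr_{D|η}(α)`, and `gr_D(α + t·η) → gr_{D|η}(α)` as `t → ∞`. -/
theorem growthRate_tendsto_of_add_null
    {V E : Type} [Fintype V] [Fintype E] (D : Multidigraph V E)
    (α η : E → ℝ)
    (hα : ∀ c : D.Cycle, 0 < D.weight α c)
    (hη : ∀ c : D.Cycle, 0 ≤ D.weight η c) :
    (∀ c : D.Cycle, D.CycleIn (D.nullSubgraph η) c → D.weight η c = 0) ∧
      (1 < D.growthRateOn (D.nullSubgraph η) α →
        (∀ t : ℝ, 0 ≤ t →
          (∀ c : D.Cycle, 0 < D.weight (fun e => α e + t * η e) c) ∧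
            D.growthRateOn (D.nullSubgraph η) α ≤
              D.growthRate (fun e => α e + t * η e)) ∧
          Filter.Tendsto (fun t : ℝ => D.growthRate (fun e => α e + t * η e))
            Filter.atTop (nhds (D.growthRateOn (D.nullSubgraph η) α))) := by
  obtain ⟨φ, ε, hε, hφ⟩ := exists_pot_alpha α hα
  obtain ⟨ψ, δ, hδ, hψ0, hψ⟩ := exists_pot_eta η hη
  set α' : E → ℝ := fun e => α e + φ (D.src e) - φ (D.tgt e) with hα'
  set η' : E → ℝ := fun e => η e + ψ (D.src e) - ψ (D.tgt e) with hη'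
  have wα : ∀ c, D.weight α' c = D.weight α c := weight_telescope φ α
  have wη : ∀ c, D.weight η' c = D.weight η c := weight_telescope ψ η
  have hN0 : ∀ e ∈ D.nullSubgraph η, η' e = 0 := null_edge_zero η η' wη hψ0
  have wt : ∀ (t : ℝ) (c : D.Cycle), D.weight (fun e => α e + t * η e) c =
      D.weight (fun e => α' e + t * η' e) c := by
    intro t c
    rw [weight_add_mul, weight_add_mul, wα, wη]
  have gN : D.growthRateOn (D.nullSubgraph η) α = D.growthRateOn (D.nullSubgraph η) α' :=
    growth_congr _ _ _ fun c => (wα c).symm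
  have gt : ∀ t : ℝ, D.growthRate (fun e => α e + t * η e) =
      D.growthRate (fun e => α' e + t * η' e) := fun t => growth_congr _ _ _ (wt t)
  refine ⟨fun c hc => ?_, fun hg1 => ?_⟩
  · rw [← wη]
    exact weight_null _ η' hN0 c hc
  have low : ∀ t : ℝ, 0 ≤ t → D.growthRateOn (D.nullSubgraph η) α ≤
      D.growthRate (fun e => α e + t * η e) := by
    intro t ht
    rw [gN, gt]
    exact growth_lower _ α' η' ε hε hφ hψ0 hN0 t ht
  refine ⟨fun t ht => ⟨fun c => ?_, low t ht⟩, ?_⟩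
  · rw [weight_add_mul]
    have := hα c
    have := mul_nonneg ht (hη c)
    linarith
  · refine tendsto_order.2 ⟨fun a ha => ?_, fun b hb => ?_⟩
    · filter_upwards [Filter.eventually_ge_atTop 0] with t ht
      exact ha.trans_le (low t ht)
    · obtain ⟨h, hh1, hh2⟩ := exists_between hb
      rw [gN] at hg1 hh1
      filter_upwards [growth_upper _ α' η' ε hε hφ hψ0 δ hδ hψ (null_return η) h hg1 hh1] with t ht
      rw [gt]
      exact ht.trans_lt hh2
end

section
/- Let Λ ⊆ ℝ be a bounded set with the following property: for every accumulation point λ of Λ and every sequence (λ_k) in Λ converging to λ, one has λ_k ≥ λ for all sufficiently large k. Then the closure of Λ is compact and is well-ordered by ≥; that is, every nonempty subset of the closure of Λ has a greatest element. -/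
/-- Let `Λ ⊆ ℝ` be a bounded set such that for every accumulation
point `x` of `Λ` and every sequence in `Λ` converging to `x`, the sequence is
eventually `≥ x`.  Then the closure of `Λ` is compact and well-ordered by `≥`:
every nonempty subset of the closure of `Λ` has a greatest element. -/
theorem closure_isCompact_and_wellOrdered_ge
    (Λ : Set ℝ) (hb : Bornology.IsBounded Λ)
    (h : ∀ x : ℝ, AccPt x (Filter.principal Λ) →
      ∀ u : ℕ → ℝ, (∀ k, u k ∈ Λ) → Filter.Tendsto u Filter.atTop (nhds x) →
        ∀ᶠ k in Filter.atTop, x ≤ u k) :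
    IsCompact (closure Λ) ∧
      ∀ S : Set ℝ, S ⊆ closure Λ → S.Nonempty → ∃ m ∈ S, ∀ x ∈ S, x ≤ m := by
  refine ⟨hb.isCompact_closure, fun S hS hne => ?_⟩
  have hbdd : BddAbove S := (hb.closure.subset hS).bddAbove
  have hl := isLUB_csSup hne hbdd
  set s := sSup S with hs
  by_cases hmem : s ∈ S
  · exact ⟨s, hmem, fun x hx => hl.1 hx⟩
  exfalso
  have key : ∀ k : ℕ, ∃ y ∈ Λ, s - 1 / ((k : ℝ) + 1) < y ∧ y < s := by
    intro k
    have hk : (0 : ℝ) < 1 / ((k : ℝ) + 1) := by positivity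
    obtain ⟨x, hx, hx1⟩ := exists_lt_of_lt_csSup hne (show s - 1 / ((k : ℝ) + 1) < sSup S by linarith)
    have hx2 : x < s := lt_of_le_of_ne (hl.1 hx) (fun e => hmem (e ▸ hx))
    obtain ⟨y, hy, hyΛ⟩ := mem_closure_iff.1 (hS hx) (Set.Ioo (s - 1 / ((k : ℝ) + 1)) s) isOpen_Ioo ⟨hx1, hx2⟩
    exact ⟨y, hyΛ, hy.1, hy.2⟩
  choose u hu h1 h2 using key
  have ht : Filter.Tendsto u Filter.atTop (nhds s) := by
    have h0 : Filter.Tendsto (fun k : ℕ => s - 1 / ((k : ℝ) + 1)) Filter.atTop (nhds s) := by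
      simpa using (tendsto_one_div_add_atTop_nhds_zero_nat (𝕜 := ℝ)).const_sub s
    exact tendsto_of_tendsto_of_tendsto_of_le_of_le h0 tendsto_const_nhds
      (fun k => (h1 k).le) (fun k => (h2 k).le)
  have hacc : AccPt s (Filter.principal Λ) := by
    rw [accPt_iff_nhds]
    intro U hU
    obtain ⟨k, hk⟩ := (ht.eventually hU).exists
    exact ⟨u k, ⟨hk, hu k⟩, (h2 k).ne⟩
  obtain ⟨k, hk⟩ := (h s hacc u hu ht).exists
  exact absurd (h2 k) (not_lt.2 hk)
end
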